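/- arXiv:1811.11749 — 4 statements merged into one kernel-verified Lean document; each statement's English description precedes it below -/
import Mathlib

section
/- Let m and q be integers, and let f be holomorphic (complex differentiable) on the open unit disc 𝔻 = {w ∈ ℂ : |w| < 1}, satisfying f(e^{−2iθ} w) · e^{−imθ} = e^{iqθ} · f(w) for all θ ∈ ℝ and all w ∈ 𝔻. If f is not identically zero on 𝔻, then there exist a natural number j and a complex constant c such that q = −m − 2j and f(w) = c · wʲ for all w ∈ 𝔻. -/
open Complex Metric

/-- The `n`-th derivative of `w ↦ f (u * w)`, with no regularity assumption on `f`. -/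
theorem iteratedDeriv_comp_const_mul_field {𝕜 : Type*} [NontriviallyNormedField 𝕜]
    (n : ℕ) (f : 𝕜 → 𝕜) (u : 𝕜) :
    iteratedDeriv n (fun w ↦ f (u * w)) = fun w ↦ u ^ n * iteratedDeriv n f (u * w) := by
  induction n with
  | zero => simp
  | succ n ih =>
    ext w
    rw [iteratedDeriv_succ, ih, deriv_const_mul_field, iteratedDeriv_succ,
      deriv_comp_mul_left u (iteratedDeriv n f) w, smul_eq_mul, pow_succ, mul_assoc]

/-- An integer character of the circle is trivial only if its weight is zero. -/
theorem int_eq_zero_of_forall_exp_I_mul_eq_one {a : ℤ}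
    (h : ∀ θ : ℝ, Complex.exp (Complex.I * a * θ) = 1) : a = 0 := by
  by_contra ha
  have ha' : (a : ℂ) ≠ 0 := by exact_mod_cast ha
  have h1 := h (Real.pi / a)
  have h2 : Complex.I * a * ((Real.pi / a : ℝ) : ℂ) = Real.pi * Complex.I := by
    push_cast
    field_simp
  rw [h2, Complex.exp_pi_mul_I] at h1
  norm_num at h1

/-- A nonvanishing Taylor coefficient at the origin determines the weight. -/
theorem weight_eq_of_iteratedDeriv_ne_zero {m q : ℤ} {f : ℂ → ℂ}
    (heq : ∀ θ : ℝ, ∀ w ∈ ball (0 : ℂ) 1,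
      f (Complex.exp (-2 * Complex.I * θ) * w) * Complex.exp (-Complex.I * m * θ) =
        Complex.exp (Complex.I * q * θ) * f w)
    {n : ℕ} (hn : iteratedDeriv n f 0 ≠ 0) : q = -m - 2 * n := by
  suffices h : q + m + 2 * n = 0 by linarith
  refine int_eq_zero_of_forall_exp_I_mul_eq_one fun θ ↦ ?_
  have hev : (fun w ↦ Complex.exp (-Complex.I * m * θ) *
      f (Complex.exp (-2 * Complex.I * θ) * w)) =ᶠ[nhds 0]
      fun w ↦ Complex.exp (Complex.I * q * θ) * f w := by
    filter_upwards [ball_mem_nhds (0 : ℂ) one_pos] with w hw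
    rw [mul_comm, heq θ w hw]
  have hD := hev.iteratedDeriv_eq n
  rw [iteratedDeriv_const_mul_field, iteratedDeriv_const_mul_field,
    iteratedDeriv_comp_const_mul_field] at hD
  simp only [mul_zero, ← mul_assoc] at hD
  have hexp := mul_right_cancel₀ hn hD
  rw [← Complex.exp_nat_mul, ← Complex.exp_add] at hexp
  have hsplit : Complex.I * ((q + m + 2 * n : ℤ) : ℂ) * θ = Complex.I * q * θ -
      (-Complex.I * m * θ + n * (-2 * Complex.I * θ)) := by
    push_cast
    ring
  rw [hsplit, Complex.exp_sub, ← hexp, div_self (Complex.exp_ne_zero _)]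

/-- A holomorphic function on the unit disc transforming under the rotations
`w ↦ e^{−2iθ} w` by the character `e^{iqθ}` (after the automorphy-factor
correction `e^{−imθ}`) is a monomial `c · wʲ` with `q = −m − 2j`, provided it is
not identically zero. -/
theorem holomorphic_rotation_equivariant_eq_monomial (m q : ℤ) (f : ℂ → ℂ)
    (hf : DifferentiableOn ℂ f (ball (0 : ℂ) 1))
    (heq : ∀ θ : ℝ, ∀ w ∈ ball (0 : ℂ) 1,
      f (Complex.exp (-2 * Complex.I * θ) * w) * Complex.exp (-Complex.I * m * θ) =
        Complex.exp (Complex.I * q * θ) * f w)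
    (hne : ∃ w ∈ ball (0 : ℂ) 1, f w ≠ 0) :
    ∃ (j : ℕ) (c : ℂ), q = -m - 2 * j ∧ ∀ w ∈ ball (0 : ℂ) 1, f w = c * w ^ j := by
  have hT := fun {w : ℂ} (hw : w ∈ ball (0 : ℂ) 1) ↦ taylorSeries_eq_on_ball' hw hf
  obtain ⟨j, hj⟩ : ∃ j, iteratedDeriv j f 0 ≠ 0 := by
    by_contra! h
    obtain ⟨w, hw, hfw⟩ := hne
    exact hfw (by simp [← hT hw, h])
  have hq := weight_eq_of_iteratedDeriv_ne_zero heq hj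
  refine ⟨j, (j.factorial : ℂ)⁻¹ * iteratedDeriv j f 0, hq, fun w hw ↦ ?_⟩
  rw [← hT hw, tsum_eq_single j, sub_zero]
  intro n hn
  have hzero : iteratedDeriv n f 0 = 0 := by
    by_contra h
    have hq' := weight_eq_of_iteratedDeriv_ne_zero heq h
    omega
  simp [hzero]
end

section
/- The principal congruence subgroup Γ(4) of SL(2,ℤ) is isomorphic, as a group, to the free group on 5 generators. -/
open CongruenceSubgroup

namespace GammaFour

open Matrix MatrixGroups

/-- The matrix `[1, 2; 0, 1]`. -/
def upper : SL(2, ℤ) := ⟨!![1, 2; 0, 1], by simp⟩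

/-- The matrix `[1, 0; 2, 1]`. -/
def lower : SL(2, ℤ) := ⟨!![1, 0; 2, 1], by simp⟩

/-- The homomorphism from the free group of rank two onto the Sanov subgroup of `SL(2, ℤ)`. -/
def sanov : FreeGroup (Fin 2) →* SL(2, ℤ) := FreeGroup.lift ![upper, lower]

lemma re_upper_smul (z : UpperHalfPlane) : (upper • z).re = z.re + 2 := by
  rw [← UpperHalfPlane.coe_re, UpperHalfPlane.specialLinearGroup_apply]
  simp [upper]

lemma re_upper_inv_smul (z : UpperHalfPlane) : (upper⁻¹ • z).re = z.re - 2 := by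
  have h := re_upper_smul (upper⁻¹ • z)
  rw [smul_inv_smul] at h
  linarith

/-- The real part of `z⁻¹`, written in terms of the coordinates of `z`. -/
noncomputable def reInv (z : UpperHalfPlane) : ℝ := z.re / (z.re ^ 2 + z.im ^ 2)

lemma reInv_eq (z : UpperHalfPlane) : reInv z = ((z : ℂ)⁻¹).re := by
  simp [reInv, Complex.inv_re, Complex.normSq_apply, pow_two]

lemma reInv_lower_smul (z : UpperHalfPlane) : reInv (lower • z) = reInv z + 2 := by
  have hz : (z : ℂ) ≠ 0 := z.ne_zero
  have h : ((lower • z : UpperHalfPlane) : ℂ)⁻¹ = (z : ℂ)⁻¹ + 2 := by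
    rw [UpperHalfPlane.specialLinearGroup_apply]
    simp [lower]
    field_simp
    ring
  rw [reInv_eq, reInv_eq, h]
  simp

lemma reInv_lower_inv_smul (z : UpperHalfPlane) : reInv (lower⁻¹ • z) = reInv z - 2 := by
  have h := reInv_lower_smul (lower⁻¹ • z)
  rw [smul_inv_smul] at h
  linarith

lemma re_mul_reInv_lt_one (z : UpperHalfPlane) : z.re * reInv z < 1 := by
  have := z.im_pos
  rw [reInv, ← mul_div_assoc, div_lt_one (by positivity)]
  nlinarith

lemma re_mul_reInv_nonneg (z : UpperHalfPlane) : 0 ≤ z.re * reInv z := by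
  rw [reInv, ← mul_div_assoc]
  exact div_nonneg (mul_self_nonneg _) (by positivity)

theorem sanov_injective : Function.Injective sanov := by
  refine FreeGroup.injective_lift_of_ping_pong ![upper, lower] (α := UpperHalfPlane)
    ![{z | 1 ≤ z.re}, {z | 1 < reInv z}] ![{z | z.re < -1}, {z | reInv z ≤ -1}]
    ?_ ?_ ?_ ?_ ?_ ?_
  · simp only [Fin.forall_fin_two]
    refine ⟨⟨⟨⟨1, 1⟩, one_pos⟩, le_refl (1 : ℝ)⟩, ⟨⟨⟨1 / 4, 1 / 8⟩, by norm_num⟩, ?_⟩⟩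
    change (1 : ℝ) < (1 / 4) / ((1 / 4) ^ 2 + (1 / 8) ^ 2)
    norm_num
  · simp only [Pairwise, Fin.forall_fin_two, Function.onFun, Set.disjoint_left]
    simp
    refine ⟨fun z h => ?_, fun z h => ?_⟩ <;> nlinarith [re_mul_reInv_lt_one z]
  · simp only [Pairwise, Fin.forall_fin_two, Function.onFun, Set.disjoint_left]
    simp
    refine ⟨fun z h => ?_, fun z h => ?_⟩ <;> by_contra! <;> nlinarith [re_mul_reInv_lt_one z]
  · simp only [Fin.forall_fin_two, Set.disjoint_left]
    simp
    refine ⟨⟨fun z h => ?_, fun z h => ?_⟩, fun z h => ?_, fun z h => ?_⟩ <;>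
      first | linarith | (by_contra!; nlinarith [re_mul_reInv_nonneg z])
  · simp only [Fin.forall_fin_two, Set.smul_set_subset_iff]
    refine ⟨fun z (h : ¬ z.re < -1) => ?_, fun z (h : ¬ reInv z ≤ -1) => ?_⟩
    · change 1 ≤ (upper • z).re
      linarith [re_upper_smul z]
    · change 1 < reInv (lower • z)
      linarith [reInv_lower_smul z]
  · simp only [Fin.forall_fin_two, Set.smul_set_subset_iff]
    refine ⟨fun z (h : ¬ 1 ≤ z.re) => ?_, fun z (h : ¬ 1 < reInv z) => ?_⟩
    · change (upper⁻¹ • z).re < -1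
      linarith [re_upper_inv_smul z]
    · change reInv (lower⁻¹ • z) ≤ -1
      linarith [reInv_lower_inv_smul z]

lemma upper_mem_range_sanov : upper ∈ sanov.range := ⟨FreeGroup.of 0, by simp [sanov]⟩

lemma lower_mem_range_sanov : lower ∈ sanov.range := ⟨FreeGroup.of 1, by simp [sanov]⟩

lemma coe_upper : (upper : Matrix (Fin 2) (Fin 2) ℤ) = !![1, 2; 0, 1] := rfl

lemma coe_lower : (lower : Matrix (Fin 2) (Fin 2) ℤ) = !![1, 0; 2, 1] := rfl

lemma upper_mul (g : SL(2, ℤ)) :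
    (upper * g) 0 0 = g 0 0 + 2 * g 1 0 ∧ (upper * g) 0 1 = g 0 1 + 2 * g 1 1 ∧
    (upper * g) 1 0 = g 1 0 := by
  simp [coe_upper, Matrix.mul_apply, Fin.sum_univ_two]

lemma upper_inv_mul (g : SL(2, ℤ)) :
    (upper⁻¹ * g) 0 0 = g 0 0 - 2 * g 1 0 ∧ (upper⁻¹ * g) 0 1 = g 0 1 - 2 * g 1 1 ∧
    (upper⁻¹ * g) 1 0 = g 1 0 := by
  simp [coe_upper, Matrix.mul_apply, Fin.sum_univ_two, Matrix.adjugate_fin_two]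
  constructor <;> ring

lemma lower_mul (g : SL(2, ℤ)) :
    (lower * g) 0 0 = g 0 0 ∧ (lower * g) 0 1 = g 0 1 ∧
    (lower * g) 1 0 = g 1 0 + 2 * g 0 0 := by
  simp [coe_lower, Matrix.mul_apply, Fin.sum_univ_two]
  ring

lemma lower_inv_mul (g : SL(2, ℤ)) :
    (lower⁻¹ * g) 0 0 = g 0 0 ∧ (lower⁻¹ * g) 0 1 = g 0 1 ∧
    (lower⁻¹ * g) 1 0 = g 1 0 - 2 * g 0 0 := by
  simp [coe_lower, Matrix.mul_apply, Fin.sum_univ_two, Matrix.adjugate_fin_two]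
  ring

lemma upper_zpow (n : ℤ) : ((upper ^ n : SL(2, ℤ)) : Matrix (Fin 2) (Fin 2) ℤ) =
    !![1, 2 * n; 0, 1] := by
  have h : upper = ModularGroup.T ^ (2 : ℤ) := by
    ext i j
    rw [ModularGroup.coe_T_zpow]
    rfl
  rw [h, ← _root_.zpow_mul, ModularGroup.coe_T_zpow]

theorem mem_range_sanov (g : SL(2, ℤ)) (ha : g 0 0 % 4 = 1) (hb : g 0 1 % 2 = 0)
    (hc : g 1 0 % 2 = 0) : g ∈ sanov.range := by
  induction hn : (g 0 0).natAbs + (g 1 0).natAbs using Nat.strong_induction_on generalizing g with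
  | _ n ih =>
  by_cases h0 : g 1 0 = 0
  · have hdet := g.det_coe
    rw [Matrix.det_fin_two, h0, mul_zero, sub_zero] at hdet
    have hd : g 0 0 = 1 ∧ g 1 1 = 1 := by
      rcases Int.eq_one_or_neg_one_of_mul_eq_one' hdet with h | h
      · exact h
      · omega
    have hg : g = upper ^ (g 0 1 / 2) := by
      apply Subtype.ext
      rw [upper_zpow]
      ext i j
      fin_cases i <;> fin_cases j <;> simp [h0, hd]
      omega
    rw [hg]
    exact zpow_mem upper_mem_range_sanov _
  · have hu := upper_mul g
    have hu' := upper_inv_mul g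
    have hl := lower_mul g
    have hl' := lower_inv_mul g
    have key : ∀ s ∈ sanov.range, (s * g) 0 0 % 4 = 1 → (s * g) 0 1 % 2 = 0 →
        (s * g) 1 0 % 2 = 0 → ((s * g) 0 0).natAbs + ((s * g) 1 0).natAbs < n →
        g ∈ sanov.range := fun s hs h1 h2 h3 h4 =>
      (Subgroup.mul_mem_cancel_left _ hs).mp (ih _ h4 _ h1 h2 h3 rfl)
    by_cases hlt : (g 0 0).natAbs < (g 1 0).natAbs
    · by_cases hs : 0 < g 0 0 ↔ 0 < g 1 0
      · refine key _ (inv_mem lower_mem_range_sanov) ?_ ?_ ?_ ?_ <;> omega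
      · refine key _ lower_mem_range_sanov ?_ ?_ ?_ ?_ <;> omega
    · by_cases hs : 0 < g 0 0 ↔ 0 < g 1 0
      · refine key _ (inv_mem upper_mem_range_sanov) ?_ ?_ ?_ ?_ <;> omega
      · refine key _ upper_mem_range_sanov ?_ ?_ ?_ ?_ <;> omega

/-- Free generators of the kernel of `FreeGroup (Fin 2) → (ℤ / 2)²`. -/
def kernelGen : Fin 5 → FreeGroup (Fin 2) :=
  let a := FreeGroup.of 0
  let b := FreeGroup.of 1
  ![a * a, b⁻¹ * a * a * b, b * b, b⁻¹ * a⁻¹ * b * a, a⁻¹ * b * a * b]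

/-- Coset representatives of the kernel of `FreeGroup (Fin 2) → (ℤ / 2)²`. -/
def cosetRep : Fin 4 → FreeGroup (Fin 2) :=
  ![1, FreeGroup.of 0, FreeGroup.of 1, FreeGroup.of 0 * FreeGroup.of 1]

/-- The permutation of `α × G` which moves the first coordinate by the involution `σ` and
translates the second one by an element depending on the first. -/
def monomialPerm {α G : Type*} [Group G] (σ : α → α) (hσ : Function.Involutive σ) (c : α → G) :
    Equiv.Perm (α × G) where
  toFun p := (σ p.1, c p.1 * p.2)
  invFun p := (σ p.1, (c (σ p.1))⁻¹ * p.2)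
  left_inv p := by simp [hσ p.1]
  right_inv p := by simp [hσ p.1]

/-- The action of the free group of rank two on itself, written in the coordinates given by
`cosetRep` and `kernelGen`. -/
def schreierAction : FreeGroup (Fin 2) →* Equiv.Perm (Fin 4 × FreeGroup (Fin 5)) :=
  FreeGroup.lift ![
    monomialPerm ![1, 0, 3, 2] (by unfold Function.Involutive; decide)
      ![1, FreeGroup.of 0, 1, FreeGroup.of 1],
    monomialPerm ![2, 3, 0, 1] (by unfold Function.Involutive; decide)
      ![1, FreeGroup.of 3, FreeGroup.of 2, FreeGroup.of 4]]

lemma schreierAction_lift_kernelGen (y x : FreeGroup (Fin 5)) :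
    schreierAction (FreeGroup.lift kernelGen y) (0, x) = (0, y * x) := by
  induction y using FreeGroup.induction_on generalizing x with
  | C1 => simp
  | of i =>
    fin_cases i <;> simp [kernelGen, schreierAction, monomialPerm]
  | inv_of i ih =>
    rw [map_inv, map_inv, Equiv.Perm.inv_eq_iff_eq, ih]
    simp
  | mul y z hy hz => rw [map_mul, map_mul, Equiv.Perm.mul_apply, hz, hy, mul_assoc]

theorem lift_kernelGen_injective : Function.Injective (FreeGroup.lift kernelGen) := by
  rw [injective_iff_map_eq_one]
  intro y hy
  simpa [hy] using (schreierAction_lift_kernelGen y 1).symm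

lemma cosetRep_mul_schreierAction (w : FreeGroup (Fin 2)) (p : Fin 4 × FreeGroup (Fin 5)) :
    cosetRep (schreierAction w p).1 * FreeGroup.lift kernelGen (schreierAction w p).2 =
      w * (cosetRep p.1 * FreeGroup.lift kernelGen p.2) := by
  induction w using FreeGroup.induction_on generalizing p with
  | C1 => simp
  | of i =>
    obtain ⟨v, x⟩ := p
    fin_cases i <;> fin_cases v <;>
      simp [kernelGen, cosetRep, schreierAction, monomialPerm, mul_assoc]
  | inv_of i ih =>
    have h := ih ((schreierAction (FreeGroup.of i))⁻¹ p)
    rw [Equiv.Perm.coe_inv, Equiv.apply_symm_apply] at h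
    rw [map_inv, Equiv.Perm.coe_inv, ← mul_right_inj (FreeGroup.of i), ← h,
      mul_inv_cancel_left]
  | mul y z hy hz => rw [map_mul, Equiv.Perm.mul_apply, hy, hz, mul_assoc]

lemma sanov_kernelGen_mem (i : Fin 5) : sanov (kernelGen i) ∈ Gamma 4 := by
  rw [Gamma_mem']
  fin_cases i <;> simp [kernelGen, sanov] <;> decide

lemma eq_zero_of_sanov_cosetRep_mem (v : Fin 4) (h : sanov (cosetRep v) ∈ Gamma 4) : v = 0 := by
  rw [Gamma_mem'] at h
  revert h
  fin_cases v <;> simp [cosetRep, sanov] <;> decide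

lemma sanov_lift_kernelGen_mem (x : FreeGroup (Fin 5)) :
    sanov (FreeGroup.lift kernelGen x) ∈ Gamma 4 := by
  induction x using FreeGroup.induction_on with
  | C1 => simp
  | of i => simpa using sanov_kernelGen_mem i
  | inv_of i ih => simpa using ih
  | mul y z hy hz => simpa using mul_mem hy hz

/-- The homomorphism from the free group of rank five to `Γ(4)`. -/
def toGammaFour : FreeGroup (Fin 5) →* Gamma 4 :=
  (sanov.comp (FreeGroup.lift kernelGen)).codRestrict (Gamma 4) sanov_lift_kernelGen_mem

theorem toGammaFour_bijective : Function.Bijective toGammaFour := by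
  constructor
  · intro x y h
    exact lift_kernelGen_injective (sanov_injective (congrArg Subtype.val h))
  · rintro ⟨g, hg⟩
    obtain ⟨w, rfl⟩ : g ∈ sanov.range := by
      obtain ⟨ha, hb, hc, -⟩ := Gamma_mem.mp hg
      have ha' := (ZMod.intCast_eq_intCast_iff_dvd_sub 1 (g 0 0) 4).mp (by simpa using ha.symm)
      have hb' := (ZMod.intCast_zmod_eq_zero_iff_dvd _ 4).mp hb
      have hc' := (ZMod.intCast_zmod_eq_zero_iff_dvd _ 4).mp hc
      refine mem_range_sanov g ?_ ?_ ?_ <;> omega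
    have h := cosetRep_mul_schreierAction w (0, 1)
    simp only [cosetRep, map_one, mul_one, Matrix.cons_val_zero] at h
    change cosetRep _ * _ = _ at h
    generalize schreierAction w (0, 1) = p at h
    subst h
    rw [map_mul] at hg
    have hp := eq_zero_of_sanov_cosetRep_mem p.1
      ((Subgroup.mul_mem_cancel_right _ (sanov_lift_kernelGen_mem p.2)).mp hg)
    refine ⟨p.2, Subtype.ext ?_⟩
    simp [toGammaFour, hp, cosetRep]

end GammaFour

/-- The principal congruence subgroup `Γ(4)` of `SL(2, ℤ)` is a free group on
`5` generators. -/
theorem gamma_four_free : Nonempty (Gamma 4 ≃* FreeGroup (Fin 5)) :=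
  ⟨(MulEquiv.ofBijective GammaFour.toGammaFour GammaFour.toGammaFour_bijective).symm⟩
end

section
/- Let q be an odd prime power, let 𝔽_q be a finite field with q elements and 𝔽_{q²} its quadratic extension, and let ν be a character of 𝔽_qˣ. Then the number of regular characters θ of 𝔽_{q²}ˣ whose restriction to 𝔽_qˣ (via the field inclusion 𝔽_q ⊆ 𝔽_{q²}) equals ν is q − 1 if ν^{(q−1)/2} is the trivial character, and q + 1 if ν^{(q−1)/2} is not the trivial character. -/
/-- Restriction of characters along an injective homomorphism of finite abelian groups is
surjective. -/
lemma MonoidHom.compHom'_surjective_of_injective {A B M : Type*} [CommGroup A] [CommGroup B]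
    [Finite B] [CommMonoid M] [HasEnoughRootsOfUnity M (Monoid.exponent B)]
    (f : A →* B) (hf : Function.Injective f) :
    Function.Surjective (MonoidHom.compHom' f : (B →* Mˣ) →* (A →* Mˣ)) := by
  intro ν
  let e := MonoidHom.ofInjective hf
  obtain ⟨θ, hθ⟩ := MonoidHom.domRestrict_surjective M f.range (ν.comp e.symm.toMonoidHom)
  refine ⟨θ, MonoidHom.ext fun a ↦ ?_⟩
  have h := DFunLike.congr_fun hθ (e a)
  simpa [e] using! h

section CyclicSurjection

variable {D B : Type*} [CommGroup D] [CommGroup B] [Finite D] [IsCyclic D] {m : ℕ}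
  (hD : Nat.card D = 2 * m * (2 * m + 2)) (hB : Nat.card B = 2 * m)
  {r : D →* B} (hr : Function.Surjective r)

include hD hB hr

lemma exists_generator_pow_eq_one_iff :
    ∃ g : D, (∀ x : D, ∃ n : ℕ, g ^ n = x) ∧
      (∀ n : ℕ, g ^ n = 1 ↔ 2 * m * (2 * m + 2) ∣ n) ∧
      (∀ n : ℕ, r g ^ n = 1 ↔ 2 * m ∣ n) := by
  obtain ⟨g, hg⟩ := IsCyclic.exists_monoid_generator (α := D)
  have hrg : ∀ y : B, y ∈ Subgroup.zpowers (r g) := fun y ↦ by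
    obtain ⟨x, rfl⟩ := hr y
    obtain ⟨n, rfl⟩ := hg x
    exact ⟨n, by simp⟩
  refine ⟨g, hg, fun n ↦ ?_, fun n ↦ ?_⟩
  · rw [← hD, ← orderOf_dvd_iff_pow_eq_one, orderOf_eq_card_of_forall_mem_powers hg]
  · rw [← hB, ← orderOf_dvd_iff_pow_eq_one, orderOf_eq_card_of_forall_mem_zpowers hrg]

lemma map_eq_one_and_pow_eq_one_iff_sq_eq_one (hm : 0 < m) (x : D) :
    r x = 1 ∧ x ^ (2 * m) = 1 ↔ x ^ 2 = 1 := by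
  obtain ⟨g, hg, hgD, hgB⟩ := exists_generator_pow_eq_one_iff hD hB hr
  obtain ⟨n, rfl⟩ := hg x
  rw [map_pow, hgB, ← pow_mul, ← pow_mul, hgD, hgD, mul_comm n, Nat.mul_dvd_mul_iff_left (by omega)]
  constructor
  · rintro ⟨⟨a, ha⟩, ⟨b, hb⟩⟩
    have : m * a = (m + 1) * b := by linarith
    obtain ⟨c, rfl⟩ : m ∣ b := (Nat.Coprime.dvd_of_dvd_mul_left (by simp) ⟨a, this.symm⟩)
    exact ⟨c, by rw [hb]; ring⟩
  · rintro ⟨c, hc⟩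
    have : n = 2 * m * (m + 1) * c := by linarith
    exact ⟨⟨(m + 1) * c, by rw [this]; ring⟩, ⟨m * c, by rw [this]; ring⟩⟩

lemma exists_pow_eq_one_and_map_eq_iff (hm : 0 < m) (ν : B) :
    (∃ x : D, x ^ (2 * m) = 1 ∧ r x = ν) ↔ ν ^ m = 1 := by
  obtain ⟨g, hg, hgD, hgB⟩ := exists_generator_pow_eq_one_iff hD hB hr
  constructor
  · rintro ⟨x, hx, rfl⟩
    obtain ⟨n, rfl⟩ := hg x
    rw [← pow_mul, hgD, mul_comm n, Nat.mul_dvd_mul_iff_left (by omega)] at hx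
    obtain ⟨k, rfl⟩ := hx
    rw [map_pow, ← pow_mul, hgB]
    exact ⟨(m + 1) * k, by ring⟩
  · intro h
    obtain ⟨x, rfl⟩ := hr ν
    obtain ⟨n, rfl⟩ := hg x
    rw [map_pow, ← pow_mul, hgB, Nat.mul_dvd_mul_iff_right hm] at h
    obtain ⟨k, rfl⟩ := h
    refine ⟨g ^ ((2 * m + 2) * k), ?_, ?_⟩
    · rw [← pow_mul, hgD]
      exact ⟨k, by ring⟩
    · have h1 : r g ^ (2 * m) = 1 := (hgB _).2 dvd_rfl
      rw [map_pow, map_pow, add_mul, pow_add, pow_mul, h1, one_pow, one_mul]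

lemma card_pow_eq_one_and_map_eq (hm : 0 < m) (ν : B) [Decidable (ν ^ m = 1)] :
    Nat.card {x : D // x ^ (2 * m) = 1 ∧ r x = ν} = if ν ^ m = 1 then 2 else 0 := by
  have hex := exists_pow_eq_one_and_map_eq_iff hD hB hr hm ν
  split_ifs with h <;> rw [← hex] at h
  · obtain ⟨x₀, hx₀, rfl⟩ := h
    have hker : (r.prod (powMonoidHom (2 * m))).ker = (powMonoidHom 2 : D →* D).ker := by
      ext x
      simpa [MonoidHom.mem_ker] using map_eq_one_and_pow_eq_one_iff_sq_eq_one hD hB hr hm x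
    calc _ = Nat.card (r.prod (powMonoidHom (2 * m)) ⁻¹' {r.prod (powMonoidHom (2 * m)) x₀}) :=
          Nat.card_congr (Equiv.subtypeEquivRight fun x ↦ by simp [hx₀, and_comm])
      _ = 2 := by
          rw [Nat.card_congr (MonoidHom.fiberEquivKer _ x₀), hker, IsCyclic.card_powMonoidHom_ker,
            hD]
          exact Nat.gcd_eq_right ⟨m * (2 * m + 2), by ring⟩
  · have : IsEmpty {x : D // x ^ (2 * m) = 1 ∧ r x = ν} := ⟨fun x ↦ h ⟨x, x.2⟩⟩
    exact Nat.card_of_isEmpty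

omit [Finite D] [IsCyclic D] in
lemma card_map_eq (hm : 0 < m) (ν : B) : Nat.card {x : D // r x = ν} = 2 * m + 2 := by
  have h := r.ker.card_mul_index
  rw [Subgroup.index_ker, MonoidHom.range_eq_top.2 hr, Subgroup.card_top, hB, hD, mul_comm] at h
  exact (Nat.card_congr (MonoidHom.fiberEquivKerOfSurjective hr ν)).trans
    (Nat.eq_of_mul_eq_mul_left (by omega) h)

lemma card_pow_ne_one_and_map_eq (hm : 0 < m) (ν : B) [Decidable (ν ^ m = 1)] :
    Nat.card {x : D // x ^ (2 * m) ≠ 1 ∧ r x = ν} =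
      if ν ^ m = 1 then 2 * m else 2 * m + 2 := by
  have hsum : Nat.card {x : D // x ^ (2 * m) = 1 ∧ r x = ν} +
      Nat.card {x : D // x ^ (2 * m) ≠ 1 ∧ r x = ν} = Nat.card {x : D // r x = ν} := by
    classical
    have : Fintype D := Fintype.ofFinite D
    simp only [Nat.card_eq_fintype_card, Fintype.card_subtype]
    rw [← Finset.card_filter_add_card_filter_not (s := {x : D | r x = ν})
      (fun x ↦ x ^ (2 * m) = 1), Finset.filter_filter, Finset.filter_filter]
    simp only [and_comm, ne_eq]
  rw [card_pow_eq_one_and_map_eq hD hB hr hm, card_map_eq hD hB hr hm] at hsum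
  split_ifs at hsum ⊢ <;> omega

end CyclicSurjection

open scoped Classical

/-- Counting regular characters of `𝔽_{q²}ˣ` with prescribed restriction to `𝔽_qˣ`:
if `ν` is a character of `𝔽_qˣ`, the number of regular characters `θ` of `𝔽_{q²}ˣ`
restricting to `ν` is `q − 1` when `ν^((q−1)/2)` is trivial, and `q + 1` otherwise. -/
theorem count_regular_characters_restricting_to
    (F E : Type*) [Field F] [Field E] [Fintype F] [Fintype E] [Algebra F E]
    (q : ℕ) (hq : Fintype.card F = q) (hqE : Fintype.card E = q ^ 2) (hodd : Odd q)
    (ν : Fˣ →* ℂˣ) :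
    Nat.card {θ : Eˣ →* ℂˣ //
        θ.comp (powMonoidHom q) ≠ θ ∧
        θ.comp (Units.map (algebraMap F E).toMonoidHom) = ν} =
      if ν ^ ((q - 1) / 2) = 1 then q - 1 else q + 1 := by
  obtain ⟨m, rfl⟩ := hodd
  have hm : 0 < m := by
    have := Fintype.one_lt_card (α := F)
    omega
  let e := (CommGroup.monoidHom_mulEquiv_of_hasEnoughRootsOfUnity Eˣ ℂ).some
  have : Finite (Eˣ →* ℂˣ) := Finite.of_equiv _ e.symm.toEquiv
  have : IsCyclic (Eˣ →* ℂˣ) := isCyclic_of_surjective e.symm e.symm.surjective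
  have hD : Nat.card (Eˣ →* ℂˣ) = 2 * m * (2 * m + 2) := by
    rw [CommGroup.card_monoidHom_of_hasEnoughRootsOfUnity, Nat.card_units,
      Nat.card_eq_fintype_card, hqE]
    exact Nat.sub_eq_of_eq_add (by ring)
  have hB : Nat.card (Fˣ →* ℂˣ) = 2 * m := by
    rw [CommGroup.card_monoidHom_of_hasEnoughRootsOfUnity, Nat.card_units,
      Nat.card_eq_fintype_card, hq, Nat.add_sub_cancel]
  have hr := MonoidHom.compHom'_surjective_of_injective (M := ℂ)
    (Units.map (algebraMap F E).toMonoidHom)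
    (Units.map_injective (algebraMap F E).injective)
  have hfix (θ : Eˣ →* ℂˣ) : θ.comp (powMonoidHom (2 * m + 1)) = θ ↔ θ ^ (2 * m) = 1 := by
    have : θ.comp (powMonoidHom (2 * m + 1)) = θ ^ (2 * m) * θ := by
      ext x
      simp [pow_succ]
    rw [this]
    exact mul_eq_right (a := θ ^ (2 * m)) (b := θ)
  have hhalf : (2 * m + 1 - 1) / 2 = m := by omega
  rw [hhalf, Nat.add_sub_cancel]
  refine (Nat.card_congr (Equiv.subtypeEquivRight fun θ ↦ ?_)).trans
    (card_pow_ne_one_and_map_eq hD hB hr hm ν)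
  exact and_congr_left fun _ ↦ (hfix θ).not
end

section
/- Let R be a commutative local ring whose residue field k is finite of cardinality q. Then the reduction homomorphism GL(2, R) → GL(2, k) (induced by the quotient map R → k) is surjective, and the preimage in GL(2, R) of the subgroup of upper-triangular matrices in GL(2, k) — the Iwahori subgroup — has index q + 1 in GL(2, R). -/
open Matrix

theorem Matrix.GeneralLinearGroup.map_surjective_of_isLocalHom {n R S : Type*} [Fintype n]
    [DecidableEq n] [CommRing R] [CommRing S] (f : R →+* S) [IsLocalHom f]
    (hf : Function.Surjective f) :
    Function.Surjective (Matrix.GeneralLinearGroup.map (n := n) f) := by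
  intro g
  choose A hA using fun i j => hf (g i j)
  have hmap : (Matrix.of A).map f = (g : Matrix n n S) := by
    ext i j
    exact hA i j
  have hdet : IsUnit (Matrix.of A).det := by
    rw [← isUnit_map_iff f, RingHom.map_det, RingHom.mapMatrix_apply, hmap]
    exact (Matrix.isUnit_iff_isUnit_det _).mp g.isUnit
  exact ⟨GeneralLinearGroup.mk'' (Matrix.of A) hdet, Units.ext hmap⟩

theorem OnePoint.orbit_infty_eq_univ (K : Type*) [Field K] [DecidableEq K] :
    MulAction.orbit (GL (Fin 2) K) (OnePoint.infty : OnePoint K) = Set.univ := by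
  refine Set.eq_univ_of_forall fun x => ?_
  cases x with
  | infty => exact MulAction.mem_orbit_self _
  | coe t =>
    exact ⟨GeneralLinearGroup.mkOfDetNeZero !![t, -1; 1, 0] (by simp [Matrix.det_fin_two]), by
      simp [OnePoint.smul_infty_eq_ite, GeneralLinearGroup.mkOfDetNeZero]⟩

theorem OnePoint.index_stabilizer_infty (K : Type*) [Field K] [DecidableEq K] [Fintype K] :
    (MulAction.stabilizer (GL (Fin 2) K) (OnePoint.infty : OnePoint K)).index = Fintype.card K + 1 := by
  rw [MulAction.index_stabilizer, OnePoint.orbit_infty_eq_univ, Set.ncard_univ,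
    ← Nat.card_eq_fintype_card]
  exact Finite.card_option

/-- For a commutative local ring `R` with finite residue field `k` of cardinality `q`,
the reduction map `GL(2, R) → GL(2, k)` is surjective, and the Iwahori subgroup (the
preimage of the upper-triangular matrices, i.e. those `g` whose lower-left entry lies in
the maximal ideal) has index `q + 1` in `GL(2, R)`. -/
theorem iwahori_subgroup_index (R : Type*) [CommRing R] [IsLocalRing R]
    [Fintype (IsLocalRing.ResidueField R)] :
    Function.Surjective
        (Matrix.GeneralLinearGroup.map (n := Fin 2) (IsLocalRing.residue R)) ∧
      ∃ I : Subgroup (GL (Fin 2) R),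
        (∀ g : GL (Fin 2) R,
          g ∈ I ↔ (g : Matrix (Fin 2) (Fin 2) R) 1 0 ∈ IsLocalRing.maximalIdeal R) ∧
        I.index = Fintype.card (IsLocalRing.ResidueField R) + 1 := by
  classical
  have hsurj := Matrix.GeneralLinearGroup.map_surjective_of_isLocalHom (n := Fin 2)
    (IsLocalRing.residue R) IsLocalRing.residue_surjective
  refine ⟨hsurj, (MulAction.stabilizer (GL (Fin 2) (IsLocalRing.ResidueField R))
    (OnePoint.infty : OnePoint (IsLocalRing.ResidueField R))).comap
      (Matrix.GeneralLinearGroup.map (IsLocalRing.residue R)), fun g => ?_, ?_⟩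
  · rw [Subgroup.mem_comap, MulAction.mem_stabilizer_iff, OnePoint.smul_infty_eq_self_iff,
      GeneralLinearGroup.map_apply, IsLocalRing.residue_eq_zero_iff]
  · rw [Subgroup.index_comap_of_surjective _ hsurj, OnePoint.index_stabilizer_infty]
end
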